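/- Not every SRT is output-agnostic determinizable: take U = {a,b} × ℕ. There exists an SRT T over U with Lang_oa(T) = {S = t₁⋯tₙ over U : there exist i < j and m ∈ ℕ with t_i = (a,m) and t_j = (b,m)}, and for every deterministic SRT T_d over U (with any finite number of states and registers), Lang_oa(T_d) ≠ Lang_oa(T). -/

import Mathlib

open scoped Classical

/-- A valuation over registers `R` with data elements from `U`:
a partial function from registers to data elements. -/
abbrev Val (U R : Type*) := R → Option U

/-- The everywhere-undefined valuation `♯`. -/
def Val.sharp {U R : Type*} : Val U R := fun _ => none

/-- `v.updateW W u` updates every register in `W` to hold `u`. -/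
noncomputable def Val.updateW {U R : Type*} (v : Val U R) (W : Set R) (u : U) :
    Val U R := fun r => if r ∈ W then some u else v r

/-- A condition over `(U, R)`: an arbitrary predicate on pairs of a data
element and a valuation. -/
abbrev Cond (U R : Type*) := U → Val U R → Prop

/-- `MatchCat M₁ M₂ M` states that `M = M₁ · M₂`: `M₁` and `M₂` are disjoint,
`M` is their union, and every position of `M₁` is smaller than every position
of `M₂`. -/
def MatchCat (M₁ M₂ M : Finset ℕ) : Prop :=
  Disjoint M₁ M₂ ∧ M = M₁ ∪ M₂ ∧ ∀ i ∈ M₁, ∀ j ∈ M₂, i < j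

/-- Symbolic regular expressions with memory and output over `(U, R)`.
The output `true` stands for `•` and `false` for `⊗`. -/
inductive SREMO (U R : Type*) where
  | empty : SREMO U R
  | eps : SREMO U R
  | cond (φ : Cond U R) (o : Bool) : SREMO U R
  | condW (φ : Cond U R) (o : Bool) (r : R) : SREMO U R
  | plus (e₁ e₂ : SREMO U R) : SREMO U R
  | cat (e₁ e₂ : SREMO U R) : SREMO U R
  | star (e : SREMO U R) : SREMO U R

/-- The relation `(e, S, M, v) ⊢ v'`, where the `ℕ` argument is the absolute
position (1-based) in the ambient string of the first element of the slice `S`;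
positions recorded in `M` are absolute positions. -/
inductive SREMO.Derives {U R : Type*} :
    SREMO U R → ℕ → List U → Finset ℕ → Val U R → Val U R → Prop
  | eps (off : ℕ) (v : Val U R) : Derives .eps off [] ∅ v v
  | cond {φ : Cond U R} {o : Bool} (off : ℕ) {u : U} {v : Val U R} :
      φ u v → Derives (.cond φ o) off [u] (if o then {off} else ∅) v v
  | condW {φ : Cond U R} {o : Bool} {r : R} (off : ℕ) {u : U} {v : Val U R} :
      φ u v →
      Derives (.condW φ o r) off [u] (if o then {off} else ∅) v (v.updateW {r} u)
  | plusL {e₁ e₂ : SREMO U R} {off : ℕ} {S : List U} {M : Finset ℕ}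
      {v v' : Val U R} :
      Derives e₁ off S M v v' → Derives (.plus e₁ e₂) off S M v v'
  | plusR {e₁ e₂ : SREMO U R} {off : ℕ} {S : List U} {M : Finset ℕ}
      {v v' : Val U R} :
      Derives e₂ off S M v v' → Derives (.plus e₁ e₂) off S M v v'
  | cat {e₁ e₂ : SREMO U R} {off : ℕ} {S₁ S₂ : List U} {M₁ M₂ M : Finset ℕ}
      {v v'' v' : Val U R} :
      MatchCat M₁ M₂ M → Derives e₁ off S₁ M₁ v v'' →
      Derives e₂ (off + S₁.length) S₂ M₂ v'' v' →
      Derives (.cat e₁ e₂) off (S₁ ++ S₂) M v v'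
  | starNil {e : SREMO U R} (off : ℕ) (v : Val U R) :
      Derives (.star e) off [] ∅ v v
  | starCons {e : SREMO U R} {off : ℕ} {S₁ S₂ : List U} {M₁ M₂ M : Finset ℕ}
      {v v'' v' : Val U R} :
      S₁ ≠ [] → MatchCat M₁ M₂ M → Derives e off S₁ M₁ v v'' →
      Derives (.star e) (off + S₁.length) S₂ M₂ v'' v' →
      Derives (.star e) off (S₁ ++ S₂) M v v'

/-- `Lang(e)`: the strings derivable from `e` starting with all registers empty. -/
def SREMO.Lang {U R : Type*} (e : SREMO U R) : Set (List U) :=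
  {S | ∃ (M : Finset ℕ) (v' : Val U R), e.Derives 1 S M Val.sharp v'}

/-- `Match(e, S)`: the matches of `e` on the string `S`. -/
def SREMO.Matches {U R : Type*} (e : SREMO U R) (S : List U) : Set (Finset ℕ) :=
  {M | ∃ v' : Val U R, e.Derives 1 S M Val.sharp v'}

/-- The window constraint: whenever `M ≠ ∅`, `max M - min M + 1 ≤ w`. -/
def WindowOK (M : Finset ℕ) (w : ℕ) : Prop :=
  ∀ h : M.Nonempty, M.max' h - M.min' h + 1 ≤ w

/-- `Lang(e^[1..w])`: the language of the windowed SREMO `e^[1..w]`. -/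
def SREMO.WLang {U R : Type*} (e : SREMO U R) (w : ℕ) : Set (List U) :=
  {S | ∃ (M : Finset ℕ) (v' : Val U R),
    e.Derives 1 S M Val.sharp v' ∧ WindowOK M w}

/-- A transition of a symbolic register transducer: source, condition
(`none` denotes `ε`), write registers, target, output (`true` is `•`). -/
structure SRTTransition (U State Reg : Type*) where
  src : State
  cond : Option (Cond U Reg)
  wr : Set Reg
  tgt : State
  out : Bool

/-- A symbolic register transducer over `U`. -/
structure SRT (U : Type*) where
  State : Type
  Reg : Type
  stateFinite : Finite State
  regFinite : Finite Reg
  start : State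
  final : Set State
  trans : Set (SRTTransition U State Reg)
  transFinite : trans.Finite

/-- A configuration: position, current state, current valuation. -/
structure SRTConfig (U State Reg : Type*) where
  pos : ℕ
  state : State
  val : Val U Reg

/-- `c'` is a successor of `c` via the transition `δ`, while reading `S`. -/
def SRT.Step {U : Type*} (T : SRT U) (S : List U)
    (δ : SRTTransition U T.State T.Reg)
    (c c' : SRTConfig U T.State T.Reg) : Prop :=
  δ ∈ T.trans ∧ δ.src = c.state ∧ δ.tgt = c'.state ∧
    ((δ.cond = none ∧ c'.pos = c.pos ∧ c'.val = c.val) ∨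
      (∃ (φ : Cond U T.Reg) (u : U), δ.cond = some φ ∧
        S[c.pos - 1]? = some u ∧ φ u c.val ∧
        c'.pos = c.pos + 1 ∧ c'.val = c.val.updateW δ.wr u))

/-- The positions marked when a transition `δ` is taken at position `j`:
`{j}` if `δ` is a non-ε transition with output `•`, and `∅` otherwise. -/
def SRTTransition.mark {U State Reg : Type*} (δ : SRTTransition U State Reg)
    (j : ℕ) : Finset ℕ :=
  match δ.cond, δ.out with
  | some _, true => {j}
  | _, _ => ∅

/-- A run of `T` over `S` from configuration `c` to configuration `c'`,
via the list of transitions `δs`, producing the match `M`. -/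
inductive SRT.Run {U : Type*} (T : SRT U) (S : List U) :
    SRTConfig U T.State T.Reg → List (SRTTransition U T.State T.Reg) →
      Finset ℕ → SRTConfig U T.State T.Reg → Prop
  | nil (c : SRTConfig U T.State T.Reg) : Run T S c [] ∅ c
  | cons {c c' c'' : SRTConfig U T.State T.Reg}
      {δ : SRTTransition U T.State T.Reg}
      {δs : List (SRTTransition U T.State T.Reg)} {M : Finset ℕ} :
      T.Step S δ c c' → Run T S c' δs M c'' →
      Run T S c (δ :: δs) (δ.mark c.pos ∪ M) c''

/-- The initial configuration `[1, q_s, ♯]`. -/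
def SRT.init {U : Type*} (T : SRT U) : SRTConfig U T.State T.Reg :=
  ⟨1, T.start, Val.sharp⟩

/-- `T` has an accepting run over `S` with match `M`: a run starting at
`[1, q_s, ♯]`, ending at position `|S| + 1` in a final state, whose last
transition has output `•`. -/
def SRT.AccMatch {U : Type*} (T : SRT U) (S : List U) (M : Finset ℕ) : Prop :=
  ∃ (δs : List (SRTTransition U T.State T.Reg)) (q : T.State)
    (v : Val U T.Reg) (δlast : SRTTransition U T.State T.Reg),
    T.Run S T.init δs M ⟨S.length + 1, q, v⟩ ∧ q ∈ T.final ∧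
      δs.getLast? = some δlast ∧ δlast.out = true

/-- `Match(T, S)`: the matches of the accepting runs of `T` over `S`. -/
def SRT.MatchSet {U : Type*} (T : SRT U) (S : List U) : Set (Finset ℕ) :=
  {M | T.AccMatch S M}

/-- `Lang(T)`: the strings over which `T` has an accepting run. -/
def SRT.Lang {U : Type*} (T : SRT U) : Set (List U) :=
  {S | ∃ M : Finset ℕ, T.AccMatch S M}

/-- `Lang_oa(T)`: the output-agnostic language of `T` (outputs ignored). -/
def SRT.LangOA {U : Type*} (T : SRT U) : Set (List U) :=
  {S | ∃ (δs : List (SRTTransition U T.State T.Reg)) (M : Finset ℕ)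
      (q : T.State) (v : Val U T.Reg),
      T.Run S T.init δs M ⟨S.length + 1, q, v⟩ ∧ q ∈ T.final}

/-- `T` has no ε-transitions. -/
def SRT.NoEps {U : Type*} (T : SRT U) : Prop :=
  ∀ δ ∈ T.trans, δ.cond ≠ none

/-- `T` is deterministic: it has no ε-transitions and, for every state, every
element and every valuation, at most one transition from that state has a
condition satisfied by them. -/
def SRT.Deterministic {U : Type*} (T : SRT U) : Prop :=
  T.NoEps ∧
    ∀ δ₁ ∈ T.trans, ∀ δ₂ ∈ T.trans,
      ∀ (φ₁ φ₂ : Cond U T.Reg) (u : U) (v : Val U T.Reg),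
        δ₁.src = δ₂.src → δ₁.cond = some φ₁ → δ₂.cond = some φ₂ →
          φ₁ u v → φ₂ u v → δ₁ = δ₂

/-- `T` is complete: for every state, element and valuation, at least one
transition from that state has a condition satisfied by them (together with
determinism this gives exactly one). -/
def SRT.Complete {U : Type*} (T : SRT U) : Prop :=
  ∀ (q : T.State) (u : U) (v : Val U T.Reg),
    ∃ δ ∈ T.trans, δ.src = q ∧ ∃ φ : Cond U T.Reg, δ.cond = some φ ∧ φ u v

/-- Iterated match concatenation: `MatchCatList [M₁, …, Mₙ] M` states that
`M = M₁ · M₂ ⋯ Mₙ`. -/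
inductive MatchCatList : List (Finset ℕ) → Finset ℕ → Prop
  | nil : MatchCatList [] ∅
  | cons {M₁ : Finset ℕ} {Ms : List (Finset ℕ)} {M' M : Finset ℕ} :
      MatchCatList Ms M' → MatchCat M₁ M' M → MatchCatList (M₁ :: Ms) M

/-- `T.Reads c w c'`: reading the word `w` without ε-transitions can lead `T` from the
state and valuation `c` to the state and valuation `c'`. -/
def SRT.Reads {U : Type*} (T : SRT U) :
    T.State × Val U T.Reg → List U → T.State × Val U T.Reg → Prop
  | c, [], c' => c = c'
  | c, u :: w, c' => ∃ δ ∈ T.trans, ∃ φ : Cond U T.Reg, δ.cond = some φ ∧ δ.src = c.1 ∧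
      φ u c.2 ∧ SRT.Reads T (δ.tgt, c.2.updateW δ.wr u) w c'

theorem SRT.Run.reads {U : Type*} {T : SRT U} (hT : T.NoEps) {S : List U}
    {c c' : SRTConfig U T.State T.Reg} {δs : List (SRTTransition U T.State T.Reg)}
    {M : Finset ℕ} (h : T.Run S c δs M c') (hc : 1 ≤ c.pos) (hc' : c'.pos = S.length + 1) :
    T.Reads (c.state, c.val) (S.drop (c.pos - 1)) (c'.state, c'.val) := by
  induction h with
  | nil c => simp [hc', SRT.Reads]
  | @cons c d c' δ δs M hs _ ih =>
    obtain ⟨hδ, hsrc, htgt, ⟨hε, -⟩ | ⟨φ, u, hφ, hu, hsat, hpos, hval⟩⟩ := hs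
    · exact absurd hε (hT δ hδ)
    · have ih := ih (by omega) hc'
      obtain ⟨hlt, hu⟩ := List.getElem?_eq_some_iff.1 hu
      rw [List.drop_eq_getElem_cons hlt, hu]
      refine ⟨δ, hδ, φ, hφ, hsrc, hsat, ?_⟩
      have hp : c.pos - 1 + 1 = d.pos - 1 := by omega
      rw [hp, htgt, ← hval]
      exact ih

theorem SRT.Reads.exists_run {U : Type*} {T : SRT U} {S : List U} {w : List U}
    {c c' : T.State × Val U T.Reg} (h : T.Reads c w c') (p : ℕ) (hp : p ≤ S.length)
    (hw : S.drop p = w) :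
    ∃ δs M, T.Run S ⟨p + 1, c.1, c.2⟩ δs M ⟨S.length + 1, c'.1, c'.2⟩ := by
  induction w generalizing c p with
  | nil =>
    have hp' : p = S.length := le_antisymm hp (List.drop_eq_nil_iff.1 hw)
    obtain rfl : c = c' := h
    subst hp'
    exact ⟨[], ∅, .nil _⟩
  | cons u w ih =>
    obtain ⟨δ, hδ, φ, hφ, hsrc, hsat, hr⟩ := h
    have hlt : p < S.length := by
      by_contra hge
      rw [List.drop_eq_nil_of_le (not_lt.1 hge)] at hw
      cases hw
    rw [List.drop_eq_getElem_cons hlt, List.cons.injEq] at hw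
    obtain ⟨δs, M, hrun⟩ := ih hr (p + 1) hlt hw.2
    exact ⟨δ :: δs, _, .cons ⟨hδ, hsrc, rfl, .inr ⟨φ, u, hφ, by simp [hlt, hw.1], hsat, rfl, rfl⟩⟩
      hrun⟩

theorem SRT.NoEps.mem_langOA_iff {U : Type*} {T : SRT U} (hT : T.NoEps) {S : List U} :
    S ∈ T.LangOA ↔ ∃ c, T.Reads (T.start, Val.sharp) S c ∧ c.1 ∈ T.final := by
  constructor
  · rintro ⟨δs, M, q, v, hrun, hq⟩
    exact ⟨(q, v), by simpa [SRT.init] using hrun.reads hT le_rfl rfl, hq⟩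
  · rintro ⟨c, hr, hq⟩
    obtain ⟨δs, M, hrun⟩ := hr.exists_run (S := S) 0 (Nat.zero_le _) rfl
    exact ⟨δs, M, c.1, c.2, hrun, hq⟩

theorem SRT.reads_append {U : Type*} {T : SRT U} {w₁ w₂ : List U}
    {c c' : T.State × Val U T.Reg} :
    T.Reads c (w₁ ++ w₂) c' ↔ ∃ d, T.Reads c w₁ d ∧ T.Reads d w₂ c' := by
  induction w₁ generalizing c with
  | nil => simp [SRT.Reads]
  | cons u w ih =>
    simp only [List.cons_append, SRT.Reads, ih]
    constructor
    · rintro ⟨δ, hδ, φ, hφ, hsrc, hsat, d, h₁, h₂⟩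
      exact ⟨d, ⟨δ, hδ, φ, hφ, hsrc, hsat, h₁⟩, h₂⟩
    · rintro ⟨d, ⟨δ, hδ, φ, hφ, hsrc, hsat, h₁⟩, h₂⟩
      exact ⟨δ, hδ, φ, hφ, hsrc, hsat, d, h₁, h₂⟩

theorem SRT.Deterministic.reads_unique {U : Type*} {T : SRT U} (hT : T.Deterministic)
    {w : List U} {c d d' : T.State × Val U T.Reg} (h : T.Reads c w d) (h' : T.Reads c w d') :
    d = d' := by
  induction w generalizing c with
  | nil => exact Eq.trans (Eq.symm h) h'
  | cons u w ih =>
    obtain ⟨δ, hδ, φ, hφ, hsrc, hsat, h⟩ := h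
    obtain ⟨δ', hδ', φ', hφ', hsrc', hsat', h'⟩ := h'
    obtain rfl := hT.2 δ hδ δ' hδ' φ φ' u c.2 (hsrc.trans hsrc'.symm) hφ hφ' hsat hsat'
    exact ih h h'

theorem SRT.Reads.val_mem {U : Type*} {T : SRT U} {V : Set (Option U)} {w : List U}
    {c d : T.State × Val U T.Reg} (h : T.Reads c w d) (hc : ∀ r, c.2 r ∈ V)
    (hw : ∀ u ∈ w, some u ∈ V) (r : T.Reg) : d.2 r ∈ V := by
  induction w generalizing c with
  | nil => exact (show c = d from h) ▸ hc r
  | cons u w ih =>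
    obtain ⟨δ, -, φ, -, -, -, h⟩ := h
    refine ih h (fun r => ?_) (fun x hx => hw x (List.mem_cons_of_mem _ hx))
    by_cases hr : r ∈ δ.wr
    · simpa [Val.updateW, hr] using hw u List.mem_cons_self
    · simpa [Val.updateW, hr] using hc r

theorem exists_mul_add_two_pow_lt_two_pow (C k : ℕ) : ∃ N : ℕ, C * (N + 2) ^ k < 2 ^ N := by
  have h := tendsto_pow_const_div_const_pow_of_one_lt k (r := (2 : ℝ)) one_lt_two
  have h₂ := (h.eventually_lt_const
    (show (0 : ℝ) < 1 / (4 * (C + 1)) by positivity)).and (Filter.eventually_ge_atTop 2)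
  obtain ⟨n, hn, h2n⟩ := h₂.exists
  obtain ⟨N, rfl⟩ := Nat.exists_eq_add_of_le' h2n
  refine ⟨N, ?_⟩
  rw [div_lt_div_iff₀ (by positivity) (by positivity)] at hn
  have hn' : (N + 2) ^ k * (4 * (C + 1)) < 1 * 2 ^ (N + 2) := by exact_mod_cast hn
  rw [pow_add] at hn'
  nlinarith [Nat.zero_le ((N + 2) ^ k)]

/-- The strings in which some `(a, m)` is followed by `(b, m)`. -/
def matchedPairLang : Set (List (Bool × ℕ)) :=
  {S | ∃ m w₁ w₂ w₃, S = w₁ ++ (false, m) :: (w₂ ++ (true, m) :: w₃)}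

theorem mem_matchedPairLang_iff {S : List (Bool × ℕ)} :
    S ∈ matchedPairLang ↔ ∃ (i j : ℕ) (hij : i < j) (hj : j < S.length) (m : ℕ),
      S[i]'(lt_trans hij hj) = (false, m) ∧ S[j]'hj = (true, m) := by
  constructor
  · rintro ⟨m, w₁, w₂, w₃, rfl⟩
    refine ⟨w₁.length, w₁.length + 1 + w₂.length, by omega, by simp; omega, m, by simp, ?_⟩
    rw [List.getElem_append_right (by omega)]
    simp [Nat.add_assoc, Nat.add_comm 1]
  · rintro ⟨i, j, hij, hj, m, hi, hj'⟩
    refine ⟨m, S.take i, (S.drop (i + 1)).take (j - (i + 1)), S.drop (j + 1), ?_⟩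
    have h₁ : S.drop j = (true, m) :: S.drop (j + 1) := by
      rw [List.drop_eq_getElem_cons hj, hj']
    have h₂ : S.drop i = (false, m) :: S.drop (i + 1) := by
      rw [List.drop_eq_getElem_cons (lt_trans hij hj), hi]
    have h₃ : (S.drop (i + 1)).drop (j - (i + 1)) = S.drop j := by
      rw [List.drop_drop]; congr 1; omega
    rw [← h₁, ← h₃, List.take_append_drop, ← h₂, List.take_append_drop]

/-- A word over the letters `a` followed by `(b, m)` contains a matched pair iff `(a, m)`
occurs in the word. -/
theorem map_append_mem_matchedPairLang_iff {l : List ℕ} {m : ℕ} :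
    l.map (Prod.mk false) ++ [(true, m)] ∈ matchedPairLang ↔ m ∈ l := by
  constructor
  · rw [mem_matchedPairLang_iff]
    rintro ⟨i, j, hij, hj, k, hi, hj'⟩
    have hjl : j = l.length := by
      by_contra hne
      have hlt : j < l.length := by simp at hj; omega
      rw [List.getElem_append_left (by simpa using hlt)] at hj'
      simp at hj'
    subst hjl
    rw [List.getElem_append_left (by simpa using hij)] at hi
    simp at hi hj'
    rw [hj', ← hi]
    exact List.getElem_mem _
  · intro h
    obtain ⟨s, t, rfl⟩ := List.append_of_mem h
    exact ⟨m, s.map (Prod.mk false), t.map (Prod.mk false), [], by simp⟩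

theorem SRT.Deterministic.langOA_ne_matchedPairLang {T : SRT (Bool × ℕ)}
    (hT : T.Deterministic) : T.LangOA ≠ matchedPairLang := by
  intro hL
  have := T.stateFinite
  have := T.regFinite
  let := Fintype.ofFinite T.State
  let := Fintype.ofFinite T.Reg
  obtain ⟨N, hN⟩ := exists_mul_add_two_pow_lt_two_pow (Fintype.card T.State) (Fintype.card T.Reg)
  -- Adding the letter `(a, N)` makes sure that reading the word of `A` does not get stuck.
  let word (A : Finset ℕ) : List (Bool × ℕ) := (N :: A.toList).map (Prod.mk false)
  have hacc (A : Finset ℕ) (m : ℕ) : (∃ c d, T.Reads (T.start, Val.sharp) (word A) c ∧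
      T.Reads c [(true, m)] d ∧ d.1 ∈ T.final) ↔ m = N ∨ m ∈ A := by
    have h : word A ++ [(true, m)] ∈ T.LangOA ↔ m ∈ N :: A.toList := by
      rw [hL]; exact map_append_mem_matchedPairLang_iff
    rw [hT.1.mem_langOA_iff] at h
    simp only [SRT.reads_append, List.mem_cons, Finset.mem_toList] at h
    rw [← h]
    constructor
    · rintro ⟨c, d, h₁, h₂, h₃⟩
      exact ⟨d, ⟨c, h₁, h₂⟩, h₃⟩
    · rintro ⟨d, ⟨c, h₁, h₂⟩, h₃⟩
      exact ⟨c, d, h₁, h₂, h₃⟩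
  have hex (A : Finset ℕ) : ∃ c, T.Reads (T.start, Val.sharp) (word A) c := by
    obtain ⟨c, _, h, -⟩ := (hacc A N).2 (.inl rfl)
    exact ⟨c, h⟩
  choose f hf using hex
  let V : Finset (Option (Bool × ℕ)) :=
    insert none ((Finset.range (N + 1)).image fun i => some (false, i))
  have hV : V.card ≤ N + 2 :=
    (Finset.card_insert_le _ _).trans (Nat.succ_le_succ (Finset.card_image_le.trans (by simp)))
  have hmaps : Set.MapsTo f (Finset.range N).powerset
      (Finset.univ ×ˢ Fintype.piFinset fun _ => V :
        Finset (T.State × Val (Bool × ℕ) T.Reg)) := by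
    intro A hA
    have hA : A ⊆ Finset.range N := Finset.mem_powerset.1 hA
    simp only [Finset.coe_product, Set.mem_prod, Finset.mem_coe, Finset.mem_univ, true_and,
      Fintype.mem_piFinset]
    refine (hf A).val_mem (V := V) (fun r => by simp [V, Val.sharp]) ?_
    intro u hu
    obtain ⟨i, hi, rfl⟩ := List.mem_map.1 hu
    have hiN : i < N + 1 := by
      rcases List.mem_cons.1 hi with rfl | hi
      · exact Nat.lt_succ_self _
      · exact Nat.lt_succ_of_lt (Finset.mem_range.1 (hA (Finset.mem_toList.1 hi)))
    simp only [V, Finset.coe_insert, Finset.coe_image, Set.mem_insert_iff, Set.mem_image]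
    exact .inr ⟨i, by simpa using hiN, rfl⟩
  have hmem {A B : Finset ℕ} (hA : A ⊆ Finset.range N) (hAB : f A = f B) : A ⊆ B := by
    intro m hm
    obtain ⟨c, d, h₁, h₂, h₃⟩ := (hacc A m).2 (.inr hm)
    rw [hT.reads_unique h₁ (hf A), hAB] at h₂
    exact ((hacc B m).1 ⟨_, d, hf B, h₂, h₃⟩).resolve_left (Finset.mem_range.1 (hA hm)).ne
  have hinj : Set.InjOn f (Finset.range N).powerset := by
    intro A hA B hB hAB
    exact (hmem (Finset.mem_powerset.1 hA) hAB).antisymm (hmem (Finset.mem_powerset.1 hB) hAB.symm)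
  have hcard := Finset.card_le_card_of_injOn f hmaps hinj
  rw [Finset.card_powerset, Finset.card_range, Finset.card_product, Fintype.card_piFinset,
    Finset.prod_const, Finset.card_univ, Finset.card_univ] at hcard
  exact absurd hN (not_lt.2 (hcard.trans (by gcongr)))

/-- The transitions of `matchedPairSRT`. -/
def matchedPairTrans : Set (SRTTransition (Bool × ℕ) (Fin 3) Unit) :=
  {⟨0, some fun _ _ => True, ∅, 0, true⟩,
   ⟨0, some fun u _ => u.1 = false, Set.univ, 1, true⟩,
   ⟨1, some fun _ _ => True, ∅, 1, true⟩,
   ⟨1, some fun u v => u.1 = true ∧ v () = some (false, u.2), ∅, 2, true⟩,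
   ⟨2, some fun _ _ => True, ∅, 2, true⟩}

/-- A transducer that guesses an `(a, m)`, stores it in its only register, and then guesses a
later `(b, m)`. -/
abbrev matchedPairSRT : SRT (Bool × ℕ) where
  State := Fin 3
  Reg := Unit
  stateFinite := inferInstance
  regFinite := inferInstance
  start := 0
  final := {2}
  trans := matchedPairTrans
  transFinite := by simp [matchedPairTrans]

theorem matchedPairSRT_noEps : matchedPairSRT.NoEps := by
  intro δ hδ
  rcases hδ with rfl | rfl | rfl | rfl | rfl <;> exact Option.some_ne_none _

theorem updateW_empty {U R : Type*} (v : Val U R) (u : U) : v.updateW ∅ u = v := by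
  funext r; simp [Val.updateW]

theorem updateW_univ {U R : Type*} (v : Val U R) (u : U) :
    v.updateW Set.univ u = fun _ => some u := by
  funext r; simp [Val.updateW]

theorem matchedPairSRT_reads_cons {q : Fin 3} {v : Val (Bool × ℕ) Unit} {u : Bool × ℕ}
    {w : List (Bool × ℕ)} {c : Fin 3 × Val (Bool × ℕ) Unit} :
    matchedPairSRT.Reads (q, v) (u :: w) c ↔ matchedPairSRT.Reads (q, v) w c ∨
      (q = 0 ∧ u.1 = false ∧ matchedPairSRT.Reads (1, fun _ => some u) w c) ∨
      (q = 1 ∧ u.1 = true ∧ v () = some (false, u.2) ∧ matchedPairSRT.Reads (2, v) w c) := by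
  simp only [SRT.Reads, matchedPairTrans, Set.mem_insert_iff, Set.mem_singleton_iff,
    exists_eq_or_imp, exists_eq_left, Option.some.injEq, exists_eq_left', true_and,
    updateW_empty, updateW_univ]
  constructor
  · rintro (⟨rfl, h⟩ | ⟨rfl, h⟩ | ⟨rfl, h⟩ | ⟨rfl, h⟩ | ⟨rfl, h⟩)
    · exact .inl h
    · exact .inr (.inl ⟨rfl, h⟩)
    · exact .inl h
    · exact .inr (.inr ⟨rfl, h.1.1, h.1.2, h.2⟩)
    · exact .inl h
  · rintro (h | ⟨rfl, h⟩ | ⟨rfl, h₁, h₂, h₃⟩)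
    · match q, h with
      | 0, h => exact .inl ⟨rfl, h⟩
      | 1, h => exact .inr (.inr (.inl ⟨rfl, h⟩))
      | 2, h => exact .inr (.inr (.inr (.inr ⟨rfl, h⟩)))
    · exact .inr (.inl ⟨rfl, h⟩)
    · exact .inr (.inr (.inr (.inl ⟨rfl, ⟨h₁, h₂⟩, h₃⟩)))

theorem matchedPairSRT_reads_self {q : Fin 3} {v : Val (Bool × ℕ) Unit} (w : List (Bool × ℕ)) :
    matchedPairSRT.Reads (q, v) w (q, v) := by
  induction w with
  | nil => rfl
  | cons u w ih => exact matchedPairSRT_reads_cons.2 (.inl ih)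

theorem exists_eq_append_of_matchedPairSRT_reads {v : Val (Bool × ℕ) Unit} {m : ℕ}
    (hv : v () = some (false, m)) {w : List (Bool × ℕ)} {c : Fin 3 × Val (Bool × ℕ) Unit}
    (h : matchedPairSRT.Reads (1, v) w c) (hc : c.1 = 2) :
    ∃ w₂ w₃, w = w₂ ++ (true, m) :: w₃ := by
  induction w with
  | nil =>
    obtain rfl : (1, v) = c := h
    simp at hc
  | cons u w ih =>
    rcases matchedPairSRT_reads_cons.1 h with h | ⟨h, -⟩ | ⟨-, h₁, h₂, -⟩
    · obtain ⟨w₂, w₃, rfl⟩ := ih h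
      exact ⟨u :: w₂, w₃, rfl⟩
    · exact absurd h (by decide)
    · obtain ⟨x, k⟩ := u
      obtain rfl : m = k := by simpa using hv.symm.trans h₂
      obtain rfl : x = true := h₁
      exact ⟨[], w, rfl⟩

theorem mem_matchedPairLang_of_matchedPairSRT_reads {v : Val (Bool × ℕ) Unit}
    {w : List (Bool × ℕ)} {c : Fin 3 × Val (Bool × ℕ) Unit}
    (h : matchedPairSRT.Reads (0, v) w c) (hc : c.1 = 2) : w ∈ matchedPairLang := by
  induction w with
  | nil =>
    obtain rfl : (0, v) = c := h
    simp at hc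
  | cons u w ih =>
    rcases matchedPairSRT_reads_cons.1 h with h | ⟨-, h₁, h⟩ | ⟨h, -⟩
    · obtain ⟨m, w₁, w₂, w₃, rfl⟩ := ih h
      exact ⟨m, u :: w₁, w₂, w₃, rfl⟩
    · obtain ⟨x, m⟩ := u
      obtain rfl : x = false := h₁
      obtain ⟨w₂, w₃, rfl⟩ := exists_eq_append_of_matchedPairSRT_reads rfl h hc
      exact ⟨m, [], w₂, w₃, rfl⟩
    · exact absurd h (by decide)

theorem matchedPairSRT_langOA : matchedPairSRT.LangOA = matchedPairLang := by
  ext S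
  rw [matchedPairSRT_noEps.mem_langOA_iff]
  constructor
  · rintro ⟨c, h, hc⟩
    exact mem_matchedPairLang_of_matchedPairSRT_reads h hc
  · rintro ⟨m, w₁, w₂, w₃, rfl⟩
    refine ⟨(2, fun _ => some (false, m)),
      SRT.reads_append.2 ⟨_, matchedPairSRT_reads_self w₁, ?_⟩, rfl⟩
    refine matchedPairSRT_reads_cons.2 (.inr (.inl ⟨rfl, rfl, ?_⟩))
    refine SRT.reads_append.2 ⟨_, matchedPairSRT_reads_self w₂, ?_⟩
    exact matchedPairSRT_reads_cons.2
      (.inr (.inr ⟨rfl, rfl, rfl, matchedPairSRT_reads_self w₃⟩))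

/-- Not every SRT is output-agnostic determinizable: over
`U = {a, b} × ℕ` (with `a` encoded as `false` and `b` as `true`), there is an
SRT accepting exactly the strings containing an `(a, m)` followed (strictly
later) by a `(b, m)`, and no deterministic SRT has the same output-agnostic
language. -/
theorem srt_not_determinizable :
    ∃ T : SRT (Bool × ℕ),
      T.LangOA = {S : List (Bool × ℕ) |
        ∃ (i j : ℕ) (hij : i < j) (hj : j < S.length) (m : ℕ),
          S[i]'(lt_trans hij hj) = (false, m) ∧ S[j]'hj = (true, m)} ∧
      ∀ Td : SRT (Bool × ℕ), Td.Deterministic → Td.LangOA ≠ T.LangOA := by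
  refine ⟨matchedPairSRT, ?_, fun Td hTd => ?_⟩
  · rw [matchedPairSRT_langOA]
    ext S
    exact mem_matchedPairLang_iff
  · rw [matchedPairSRT_langOA]
    exact hTd.langOA_ne_matchedPairLang
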